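/- Let p > 1, α > 0, γ ≥ 0, κ ≥ 0, and let β : [−κ, +∞) → [0, +∞) be continuous. Then there exists no function u ∈ C²([−κ, +∞)) such that −u''(x) = α (x + κ)^γ u(x)^p + β(x) for all x ∈ [−κ, +∞), u(0) = 1, and 0 ≤ u(x) ≤ 1 for all x ∈ [−κ, +∞). -/

import Mathlib

open Set

/-- If a function on a half-line has antitone derivative and is bounded below, the derivative is
nonnegative. -/
lemma nonneg_deriv_of_antitoneOn_of_bddBelow {a m : ℝ} {u u' : ℝ → ℝ}
    (hu : ∀ x ∈ Ici a, HasDerivWithinAt u (u' x) (Ici a) x)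
    (hanti : AntitoneOn u' (Ici a)) (hm : ∀ x ∈ Ici a, m ≤ u x) :
    ∀ x ∈ Ici a, 0 ≤ u' x := by
  intro y hy
  by_contra! hneg
  have hay : a ≤ y := hy
  have hmy := hm y hy
  obtain ⟨t, ht, htu⟩ : ∃ t : ℝ, 0 < t ∧ u' y * t < m - u y := by
    refine ⟨(m - u y - 1) / u' y, div_pos_of_neg_of_neg (by linarith) hneg, ?_⟩
    rw [mul_div_cancel₀ _ hneg.ne]
    linarith
  have hyt : y < y + t := by linarith
  obtain ⟨c, hc, hcu⟩ := exists_hasDerivAt_eq_slope u u' hyt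
    (fun x hx => ((hu x (hay.trans hx.1)).continuousWithinAt).mono
      (fun z hz => hay.trans hz.1))
    (fun x hx => (hu x (hay.trans hx.1.le)).hasDerivAt (Ici_mem_nhds (hay.trans_lt hx.1)))
  have hcy : u' c ≤ u' y := hanti hy (hay.trans hc.1.le) hc.1.le
  have hmt := hm (y + t) (hay.trans hyt.le)
  rw [eq_div_iff (by linarith)] at hcu
  nlinarith

theorem liouville_type_theorem
    (p α γ κ : ℝ) (hp : 1 < p) (hα : 0 < α) (hγ : 0 ≤ γ) (hκ : 0 ≤ κ)
    (β : ℝ → ℝ) (hβc : ContinuousOn β (Ici (-κ)))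
    (hβ : ∀ x ∈ Ici (-κ), 0 ≤ β x) :
    ¬ ∃ u u' u'' : ℝ → ℝ,
      (∀ x ∈ Ici (-κ), HasDerivWithinAt u (u' x) (Ici (-κ)) x) ∧
      (∀ x ∈ Ici (-κ), HasDerivWithinAt u' (u'' x) (Ici (-κ)) x) ∧
      ContinuousOn u'' (Ici (-κ)) ∧
      (∀ x ∈ Ici (-κ), -u'' x = α * (x + κ) ^ γ * u x ^ p + β x) ∧
      u 0 = 1 ∧
      (∀ x ∈ Ici (-κ), 0 ≤ u x ∧ u x ≤ 1) := by
  rintro ⟨u, u', u'', hu, hu', -, heq, h0, hb⟩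
  have hneg : ∀ x ∈ Ici (-κ), u'' x ≤ 0 := by
    intro x hx
    have hxκ : 0 ≤ x + κ := by linarith [mem_Ici.1 hx]
    have hux := (hb x hx).1
    have hpos : 0 ≤ α * (x + κ) ^ γ * u x ^ p := by positivity
    linarith [heq x hx, hβ x hx]
  have hanti : AntitoneOn u' (Ici (-κ)) :=
    antitoneOn_of_hasDerivWithinAt_nonpos (convex_Ici _)
      (fun x hx => (hu' x hx).continuousWithinAt)
      (fun x hx => (hu' x (interior_subset hx)).mono interior_subset)
      (fun x hx => hneg x (interior_subset hx))
  have hnonneg := nonneg_deriv_of_antitoneOn_of_bddBelow hu hanti (fun x hx => (hb x hx).1)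
  have hmono : MonotoneOn u (Ici (-κ)) :=
    monotoneOn_of_hasDerivWithinAt_nonneg (convex_Ici _)
      (fun x hx => (hu x hx).continuousWithinAt)
      (fun x hx => (hu x (interior_subset hx)).mono interior_subset)
      (fun x hx => hnonneg x (interior_subset hx))
  have hmem : ∀ x : ℝ, 0 ≤ x → x ∈ Ici (-κ) := fun x hx => mem_Ici.2 (by linarith)
  have hone : ∀ x : ℝ, 0 ≤ x → u x = 1 := fun x hx =>
    le_antisymm (hb x (hmem x hx)).2 (h0 ▸ hmono (hmem 0 le_rfl) (hmem x hx) hx)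
  have hnhds : ∀ x : ℝ, 0 < x → Ici (-κ) ∈ nhds x := fun x hx => Ici_mem_nhds (by linarith)
  have hu'0 : ∀ x : ℝ, 0 < x → u' x = 0 := fun x hx =>
    ((hu x (hmem x hx.le)).hasDerivAt (hnhds x hx)).unique
      ((hasDerivAt_const x (1 : ℝ)).congr_of_eventuallyEq
        (Filter.mem_of_superset (Ioi_mem_nhds hx) fun y hy => hone y (mem_Ioi.1 hy).le))
  have hu''0 : u'' 1 = 0 :=
    ((hu' 1 (hmem 1 zero_le_one)).hasDerivAt (hnhds 1 one_pos)).unique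
      ((hasDerivAt_const (1 : ℝ) (0 : ℝ)).congr_of_eventuallyEq
        (Filter.mem_of_superset (Ioi_mem_nhds one_pos) fun y hy => hu'0 y hy))
  have hpos : 0 < α * (1 + κ) ^ γ := by positivity
  have h1 := heq 1 (hmem 1 zero_le_one)
  rw [hone 1 zero_le_one, Real.one_rpow, hu''0] at h1
  linarith [hβ 1 (hmem 1 zero_le_one)]
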